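/- Let S^n be the space of n×n real symmetric matrices with the trace (Frobenius) inner product ⟨X, Y⟩ = tr(XY). Let K ⊆ S^n be a closed convex cone such that U K Uᵀ ⊆ K for every n×n real orthogonal matrix U, and let K* = { Y ∈ S^n : ⟨Y, X⟩ ≥ 0 for all X ∈ K } be its dual cone. If A ∈ K and B ∈ K* satisfy ⟨A, B⟩ = 0, then A and B commute: A B = B A. -/

import Mathlib

open Matrix

section RotationCurve

attribute [local instance] Matrix.linftyOpNormedRing Matrix.linftyOpNormedAlgebra

variable {m : Type*} [Fintype m] [DecidableEq m]

/-- The exponential of a skew-symmetric real matrix is orthogonal. -/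
theorem Matrix.exp_mem_orthogonalGroup_of_transpose_eq_neg {S : Matrix m m ℝ} (hS : Sᵀ = -S) :
    NormedSpace.exp S ∈ Matrix.orthogonalGroup m ℝ := by
  rw [Matrix.mem_orthogonalGroup_iff, ← Matrix.exp_transpose, hS,
    ← Matrix.exp_add_of_commute _ _ (Commute.refl S).neg_right, add_neg_cancel,
    NormedSpace.exp_zero]

/-- The derivative at `0` of `t ↦ tr (B exp(tS) A exp(tS)ᵀ)`. -/
theorem Matrix.hasDerivAt_trace_mul_exp_conj (A B S : Matrix m m ℝ) :
    HasDerivAt (fun t : ℝ => (B * (NormedSpace.exp (t • S) * A *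
      (NormedSpace.exp (t • S))ᵀ)).trace) (B * (S * A + A * Sᵀ)).trace 0 := by
  have hexp (T : Matrix m m ℝ) : HasDerivAt (fun t : ℝ => NormedSpace.exp (t • T)) T 0 := by
    have h := hasDerivAt_exp_smul_const (𝕂 := ℝ) T (0 : ℝ)
    rw [zero_smul, NormedSpace.exp_zero, one_mul] at h
    exact h
  have hcurve := (((hexp S).mul_const A).mul (hexp Sᵀ)).const_mul B
  have htrace := (LinearMap.toContinuousLinearMap
    (Matrix.traceLinearMap m ℝ ℝ)).hasFDerivAt.comp_hasDerivAt (0 : ℝ) hcurve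
  rw [zero_smul, zero_smul, NormedSpace.exp_zero, mul_one, one_mul] at htrace
  simp_rw [← Matrix.exp_transpose, Matrix.transpose_smul]
  exact htrace

end RotationCurve

/-- A skew-symmetric real matrix whose square has trace zero vanishes. -/
theorem Matrix.eq_zero_of_transpose_eq_neg_of_trace_mul_self {m : Type*} [Fintype m]
    {S : Matrix m m ℝ} (hS : Sᵀ = -S) (h : (S * S).trace = 0) : S = 0 := by
  rw [← Matrix.trace_conjTranspose_mul_self_eq_zero_iff,
    Matrix.conjTranspose_eq_transpose_of_trivial, hS, neg_mul, Matrix.trace_neg, h, neg_zero]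

/-- **Remark 5 of the paper, specialized to the algebra `Sⁿ` of real symmetric matrices**
(with the trace inner product `⟨X, Y⟩ = tr (X Y)`). If `K ⊆ Sⁿ` is a closed convex cone
invariant under the automorphisms `X ↦ U X Uᵀ` (`U` orthogonal), `A ∈ K`, `B` belongs to
the dual cone `K* = {Y ∈ Sⁿ : ⟨Y, X⟩ ≥ 0 for all X ∈ K}`, and `⟨A, B⟩ = 0`, then
`A B = B A`. -/
theorem complementary_pair_commute_symm_matrices {n : ℕ}
    (K : Set (Matrix (Fin n) (Fin n) ℝ))
    (hKsymm : ∀ X ∈ K, X.IsSymm)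
    (hKclosed : IsClosed K) (hKconv : Convex ℝ K)
    (hKcone : ∀ X ∈ K, ∀ c : ℝ, 0 < c → c • X ∈ K)
    (hKinv : ∀ U ∈ Matrix.orthogonalGroup (Fin n) ℝ, ∀ X ∈ K, U * X * Uᵀ ∈ K)
    (A B : Matrix (Fin n) (Fin n) ℝ)
    (hA : A ∈ K)
    (hBsymm : B.IsSymm) (hB : ∀ X ∈ K, 0 ≤ (B * X).trace)
    (hAB : (A * B).trace = 0) :
    A * B = B * A := by
  have hAsymm : Aᵀ = A := hKsymm A hA
  have hBt : Bᵀ = B := hBsymm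
  set S := A * B - B * A with hSdef
  have hS : Sᵀ = -S := by
    simp [hSdef, Matrix.transpose_mul, hAsymm, hBt]
  have hmin : IsLocalMin (fun t : ℝ => (B * (NormedSpace.exp (t • S) * A *
      (NormedSpace.exp (t • S))ᵀ)).trace) 0 := by
    refine Filter.Eventually.of_forall fun t => ?_
    have horth : NormedSpace.exp (t • S) ∈ Matrix.orthogonalGroup (Fin n) ℝ :=
      Matrix.exp_mem_orthogonalGroup_of_transpose_eq_neg (by
        rw [Matrix.transpose_smul, hS, smul_neg])
    have hzero : (B * A).trace = 0 := by rw [Matrix.trace_mul_comm, hAB]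
    simpa [hzero] using hB _ (hKinv _ horth A hA)
  have hderiv := hmin.hasDerivAt_eq_zero (Matrix.hasDerivAt_trace_mul_exp_conj A B S)
  have htrace : (S * S).trace = (B * (S * A + A * Sᵀ)).trace := by
    rw [hS, mul_add, mul_neg, mul_neg, Matrix.trace_add, Matrix.trace_neg,
      ← mul_assoc, Matrix.trace_mul_comm (B * S) A, ← mul_assoc B A S, ← mul_assoc A B S,
      ← sub_eq_add_neg, ← Matrix.trace_sub, ← sub_mul]
  exact sub_eq_zero.mp
    (Matrix.eq_zero_of_transpose_eq_neg_of_trace_mul_self hS (htrace.trans hderiv))
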